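/- Let K : ℝ³ → ℝ be measurable with |K(y)| ≤ C₀·(1+|y|²)^{-2} for all y, and let 0 ≤ k < 5/2. Then for every f ∈ L²((1+|x|²)^{-k} dx), the convolution K * f satisfies ∫_{ℝ³} (1+|x|²)^{-k} |(K*f)(x)|² dx ≤ C ∫_{ℝ³} (1+|x|²)^{-k} |f(x)|² dx, with C depending only on C₀ and k. -/

import Mathlib

open MeasureTheory

lemma aux_cs {α : Type*} [MeasurableSpace α] (μ : Measure α) (u v : α → ENNReal)
    (hu : AEMeasurable u μ) (hv : AEMeasurable v μ) :
    (∫⁻ y, u y * v y ∂μ) ^ 2 ≤ (∫⁻ y, u y ^ 2 ∂μ) * ∫⁻ y, v y ^ 2 ∂μ := by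
  have h := ENNReal.lintegral_mul_le_Lp_mul_Lq μ Real.HolderConjugate.two_two hu hv
  have h2 := pow_le_pow_left' h 2
  refine h2.trans (le_of_eq ?_)
  rw [mul_pow, ← ENNReal.rpow_natCast, ← ENNReal.rpow_natCast, ← ENNReal.rpow_mul,
    ← ENNReal.rpow_mul]
  norm_num

lemma aux_sq (a b : ENNReal) : (a + b) ^ 2 ≤ 2 * (a ^ 2 + b ^ 2) := by
  have h := ENNReal.rpow_add_le_mul_rpow_add_rpow a b (p := 2) (by norm_num)
  norm_num at h
  exact h

lemma aux_pt (k m a b c : ℝ) (hk : 0 ≤ k) (hkm : k ≤ m) (ha : 1 ≤ a) (hb : 1 ≤ b) (hc : 1 ≤ c)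
    (h : c ≤ 2 * (a + b)) :
    a ^ (-k/2) * b ^ (-2 : ℝ) ≤
      4 ^ (k/2) * (b ^ (-2 : ℝ) + a ^ (-m/2) * b ^ ((m-4)/2)) * c ^ (-k/2) := by
  have ha0 : 0 < a := by linarith
  have hb0 : 0 < b := by linarith
  have hc0 : 0 < c := by linarith
  have key : c ^ (k/2) ≤ 4 ^ (k/2) * (a ^ (k/2) + a ^ ((k-m)/2) * b ^ (m/2)) := by
    rcases le_total b a with hba | hab
    · calc c ^ (k/2) ≤ (4 * a) ^ (k/2) := by
            apply Real.rpow_le_rpow <;> linarith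
        _ = 4 ^ (k/2) * a ^ (k/2) := Real.mul_rpow (by norm_num) ha0.le
        _ ≤ _ := by
            gcongr
            have : 0 ≤ a ^ ((k-m)/2) * b ^ (m/2) := by positivity
            linarith
    · calc c ^ (k/2) ≤ (4 * b) ^ (k/2) := by
            apply Real.rpow_le_rpow <;> linarith
        _ = 4 ^ (k/2) * b ^ (k/2) := Real.mul_rpow (by norm_num) hb0.le
        _ ≤ _ := by
            gcongr
            have h1 : b ^ (k/2) = b ^ ((k-m)/2) * b ^ (m/2) := by
              rw [← Real.rpow_add hb0]; ring_nf
            have h2 : b ^ ((k-m)/2) ≤ a ^ ((k-m)/2) :=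
              Real.rpow_le_rpow_of_nonpos ha0 hab (by linarith)
            have h3 : b ^ ((k-m)/2) * b ^ (m/2) ≤ a ^ ((k-m)/2) * b ^ (m/2) := by gcongr
            have : 0 ≤ a ^ (k/2) := by positivity
            linarith
  have e1 : a ^ (-k/2) * a ^ (k/2) = 1 := by
    rw [← Real.rpow_add ha0]; ring_nf; simp
  have e2 : a ^ (-k/2) * a ^ ((k-m)/2) = a ^ (-m/2) := by
    rw [← Real.rpow_add ha0]; ring_nf
  have e3 : b ^ (-2 : ℝ) * b ^ (m/2) = b ^ ((m-4)/2) := by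
    rw [← Real.rpow_add hb0]; ring_nf
  have e4 : c ^ (k/2) * c ^ (-k/2) = 1 := by
    rw [← Real.rpow_add hc0]; ring_nf; simp
  calc a ^ (-k/2) * b ^ (-2 : ℝ)
      = a ^ (-k/2) * b ^ (-2 : ℝ) * c ^ (k/2) * c ^ (-k/2) := by rw [mul_assoc _ (c ^ (k/2)), e4, mul_one]
    _ ≤ a ^ (-k/2) * b ^ (-2 : ℝ) * (4 ^ (k/2) * (a ^ (k/2) + a ^ ((k-m)/2) * b ^ (m/2)))
          * c ^ (-k/2) := by gcongr
    _ = 4 ^ (k/2) * ((a ^ (-k/2) * a ^ (k/2)) * b ^ (-2 : ℝ) + (a ^ (-k/2) * a ^ ((k-m)/2)) *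
          (b ^ (-2 : ℝ) * b ^ (m/2))) * c ^ (-k/2) := by ring
    _ = _ := by rw [e1, e2, e3, one_mul]

abbrev E3 := EuclideanSpace ℝ (Fin 3)

/-- the power weight, with values in the extended reals -/
noncomputable def wt (s : ℝ) (x : E3) : ENNReal := ENNReal.ofReal ((1 + ‖x‖ ^ 2) ^ s)

lemma wt_meas (s : ℝ) : Measurable (wt s) := by
  unfold wt; fun_prop

lemma wt_sq (s t : ℝ) (h : t = 2 * s) (x : E3) : wt s x ^ 2 = wt t x := by
  unfold wt
  rw [← ENNReal.ofReal_pow (by positivity), ← Real.rpow_natCast, ← Real.rpow_mul (by positivity), h]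
  push_cast; ring_nf

lemma wt_int (s : ℝ) (h : s < -3/2) : ∫⁻ x, wt s x < ⊤ := by
  have := integrable_rpow_neg_one_add_norm_sq (E := E3) (μ := volume) (r := -2 * s)
    (by simp; linarith)
  have h2 := this.lintegral_lt_top
  unfold wt
  convert h2 using 6
  ring

lemma aux_main (m D : ℝ) (hm : 2 ≤ m) (hm2 : m < 5/2) :
    ∃ C : ENNReal, C ≠ ⊤ ∧ ∀ g : E3 → ENNReal, Measurable g →
      ∫⁻ x, (∫⁻ y, ENNReal.ofReal D * (wt (-2) y + wt (-m/2) x * wt ((m-4)/2) y) * g (x - y)) ^ 2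
        ≤ C * ∫⁻ x, g x ^ 2 := by
  refine ⟨ENNReal.ofReal D ^ 2 * (2 * ((∫⁻ y, wt (-2) y) * (∫⁻ y, wt (-2) y) +
    (∫⁻ y, wt (-m) y) * ∫⁻ y, wt (m-4) y)), ?_, fun g hg => ?_⟩
  · have h1 := (wt_int (-2) (by norm_num)).ne
    have h2 := (wt_int (-m) (by linarith)).ne
    have h3 := (wt_int (m-4) (by linarith)).ne
    finiteness
  have m1 := wt_meas (-2)
  have m2 := wt_meas (-m/2)
  have m3 := wt_meas ((m-4)/2)
  have m4 := wt_meas (-1)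
  have m5 := wt_meas (-m)
  have hgx : ∀ x : E3, Measurable (fun y => g (x - y)) := fun x => by fun_prop
  have hpt : ∀ x : E3,
      (∫⁻ y, ENNReal.ofReal D * (wt (-2) y + wt (-m/2) x * wt ((m-4)/2) y) * g (x - y)) ^ 2 ≤
      ENNReal.ofReal D ^ 2 * (2 * ((∫⁻ y, wt (-2) y) * (∫⁻ y, wt (-2) y * g (x - y) ^ 2) +
        wt (-m) x * ((∫⁻ y, wt (m-4) y) * ∫⁻ y, g y ^ 2))) := by
    intro x
    have e : ∫⁻ y, ENNReal.ofReal D * (wt (-2) y + wt (-m/2) x * wt ((m-4)/2) y) * g (x - y)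
        = ENNReal.ofReal D * ((∫⁻ y, wt (-2) y * g (x - y)) +
          wt (-m/2) x * ∫⁻ y, wt ((m-4)/2) y * g (x - y)) := by
      rw [← lintegral_const_mul _ (by fun_prop), ← lintegral_add_left (by fun_prop),
        ← lintegral_const_mul _ (by fun_prop)]
      congr 1; ext y; ring
    rw [e, mul_pow]
    gcongr
    refine (aux_sq _ _).trans ?_
    gcongr
    · have := aux_cs volume (wt (-1)) (fun y => wt (-1) y * g (x - y)) m4.aemeasurable
        (by fun_prop)
      simp only [mul_pow, wt_sq (-1) (-2) (by norm_num)] at this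
      simpa only [← mul_assoc, ← sq, wt_sq (-1) (-2) (by norm_num)] using this
    · rw [mul_pow, wt_sq _ (-m) (by ring)]
      gcongr
      have := aux_cs volume (wt ((m-4)/2)) (fun y => g (x - y)) m3.aemeasurable
        (by fun_prop)
      simp only [wt_sq _ (m-4) (show m - 4 = 2 * ((m-4)/2) by ring)] at this
      rwa [lintegral_sub_left_eq_self (fun y => g y ^ 2) x] at this
  refine (lintegral_mono hpt).trans (le_of_eq ?_)
  have mm : Measurable (fun x : E3 => ∫⁻ y, wt (-2) y * g (x - y) ^ 2) := by
    apply Measurable.lintegral_prod_right'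
      (f := fun p : E3 × E3 => wt (-2) p.2 * g (p.1 - p.2) ^ 2)
    fun_prop
  have sw : ∫⁻ x, ∫⁻ y, wt (-2) y * g (x - y) ^ 2 = (∫⁻ y, wt (-2) y) * ∫⁻ x, g x ^ 2 := by
    rw [lintegral_lintegral_swap (by
      apply Measurable.aemeasurable; unfold Function.uncurry; fun_prop)]
    rw [← lintegral_mul_const _ m1]
    congr 1; ext y
    rw [lintegral_const_mul _ (by fun_prop), lintegral_sub_right_eq_self (fun y => g y ^ 2) y]
  rw [lintegral_const_mul _ (by fun_prop), lintegral_const_mul _ (by fun_prop),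
    lintegral_add_left (by fun_prop), lintegral_const_mul _ mm, sw,
    lintegral_mul_const _ m5]
  ring

/-- Weighted `L²` bound for convolution with a kernel of integrable decay:
if `|K(y)| ≤ C₀(1+|y|²)^{-2}` and `0 ≤ k < 5/2`, then
`∫ (1+|x|²)^{-k}|K*f|² ≤ C ∫ (1+|x|²)^{-k}|f|²`, `C = C(C₀,k)`. -/
theorem stmt6 (C₀ k : ℝ) (hC₀ : 0 < C₀) (hk0 : 0 ≤ k) (hk : k < 5 / 2) :
    ∃ C > 0, ∀ K f : EuclideanSpace ℝ (Fin 3) → ℝ,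
      Measurable K → Measurable f →
      (∀ y, |K y| ≤ C₀ * (1 + ‖y‖ ^ 2) ^ (-2 : ℝ)) →
      Integrable (fun x => (1 + ‖x‖ ^ 2) ^ (-k) * (f x) ^ 2) →
      ∫ x, (1 + ‖x‖ ^ 2) ^ (-k) * (∫ y, K y * f (x - y)) ^ 2
        ≤ C * ∫ x, (1 + ‖x‖ ^ 2) ^ (-k) * (f x) ^ 2 := by
  obtain ⟨C, hC, H⟩ := aux_main (max k 2) (C₀ * 4 ^ (k/2)) (le_max_right _ _)
    (max_lt hk (by norm_num))
  set m := max k 2 with hm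
  refine ⟨C.toReal + 1, by positivity, fun K f hK hf hb hint => ?_⟩
  have hR0 : 0 ≤ ∫ x, (1 + ‖x‖ ^ 2) ^ (-k) * (f x) ^ 2 :=
    integral_nonneg fun x => by positivity
  by_cases hL : Integrable (fun x => (1 + ‖x‖ ^ 2) ^ (-k) * (∫ y, K y * f (x - y)) ^ 2)
  swap
  · rw [integral_undef hL]; positivity
  refine le_trans ?_ (mul_le_mul_of_nonneg_right (le_add_of_nonneg_right zero_le_one) hR0)
  rw [← ENNReal.ofReal_le_ofReal_iff (by positivity), ENNReal.ofReal_mul (by positivity),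
    ENNReal.ofReal_toReal hC,
    ofReal_integral_eq_lintegral_ofReal hL (ae_of_all _ fun x => by positivity),
    ofReal_integral_eq_lintegral_ofReal hint (ae_of_all _ fun x => by positivity)]
  have mk := wt_meas (-k/2)
  have key := H (fun z => wt (-k/2) z * ‖f z‖ₑ) (by fun_prop)
  have sqe : ∀ (x : E3) (r : ℝ), ENNReal.ofReal ((1 + ‖x‖ ^ 2) ^ (-k) * r ^ 2)
      = (wt (-k/2) x * ‖r‖ₑ) ^ 2 := by
    intro x r
    rw [mul_pow, wt_sq _ (-k) (by ring), ENNReal.ofReal_mul (by positivity), ← sq_abs r,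
      ENNReal.ofReal_pow (abs_nonneg _), Real.enorm_eq_ofReal_abs]
    rfl
  simp only [sqe]
  refine le_trans (lintegral_mono fun x => ?_) key
  apply pow_le_pow_left'
  refine (mul_le_mul_right (enorm_integral_le_lintegral_enorm _) _).trans ?_
  rw [← lintegral_const_mul _ (by fun_prop)]
  refine lintegral_mono fun y => ?_
  have hp := aux_pt k m (1 + ‖x‖^2) (1 + ‖y‖^2) (1 + ‖x - y‖^2) hk0 (le_max_left _ _)
    (by nlinarith [sq_nonneg ‖x‖]) (by nlinarith [sq_nonneg ‖y‖]) (by nlinarith [sq_nonneg ‖x-y‖])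
    (by
      have := norm_sub_le x y
      nlinarith [sq_nonneg (‖x‖ - ‖y‖), norm_nonneg (x - y), norm_nonneg x, norm_nonneg y])
  simp only [wt, Real.enorm_eq_ofReal_abs]
  rw [← ENNReal.ofReal_mul (by positivity), ← ENNReal.ofReal_mul (by positivity),
    ← ENNReal.ofReal_mul (by positivity), ← ENNReal.ofReal_add (by positivity) (by positivity),
    ← ENNReal.ofReal_mul (by positivity), ← ENNReal.ofReal_mul (by positivity)]
  apply ENNReal.ofReal_le_ofReal
  rw [abs_mul]
  calc (1 + ‖x‖^2) ^ (-k/2) * (|K y| * |f (x - y)|)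
      ≤ (1 + ‖x‖^2) ^ (-k/2) * ((C₀ * (1 + ‖y‖ ^ 2) ^ (-2 : ℝ)) * |f (x - y)|) := by
        gcongr; exact hb y
    _ = C₀ * ((1 + ‖x‖^2) ^ (-k/2) * (1 + ‖y‖ ^ 2) ^ (-2 : ℝ)) * |f (x - y)| := by ring
    _ ≤ C₀ * (4 ^ (k/2) * ((1 + ‖y‖ ^ 2) ^ (-2 : ℝ) + (1 + ‖x‖^2) ^ (-m/2) *
          (1 + ‖y‖ ^ 2) ^ ((m-4)/2)) * (1 + ‖x - y‖^2) ^ (-k/2)) * |f (x - y)| := by gcongr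
    _ = _ := by ring
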